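/- There exist absolute positive constants c₈ and c₉ such that the following holds. Let τ > 0 and let ξ be a real random variable with E ξ = 0 and Var ξ = σ² > 0 whose distribution F belongs to the class A₁(τ), and suppose τ/σ ≤ c₉. Then for every x with 2σ ≤ x ≤ σ²/(5τ), one has 1 − F(x) = (1 − Φ(x))·exp(θ c₈ (τ/σ)(x/σ)³) for some real θ with |θ| ≤ 1, where F(·) is the distribution function of F and Φ(·) is the distribution function of the Gaussian law with mean 0 and variance σ². -/

import Mathlib

open MeasureTheory ProbabilityTheory

noncomputable section

/-- `φ` is the cumulant generating function (analytic logarithm of the Laplace transform,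
normalized by `φ 0 = 0`) of `μ` on the disc `{z : ‖z‖ * τ < 1}`, with third derivative
bounded by `τ · Var μ`.  This is the defining property of the class `A₁(τ)`. -/
def IsCGF (φ : ℂ → ℂ) (τ : ℝ) (μ : Measure ℝ) : Prop :=
  φ 0 = 0 ∧ ∀ z : ℂ, ‖z‖ * τ < 1 →
    Integrable (fun x : ℝ => Complex.exp (z * x)) μ ∧
    Complex.exp (φ z) = ∫ x : ℝ, Complex.exp (z * x) ∂μ ∧
    AnalyticAt ℂ φ z ∧
    ‖iteratedDeriv 3 φ z‖ ≤ τ * variance id μ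

/-- The class `A₁(τ)` of distributions on `ℝ`. -/
def MemA1 (τ : ℝ) (μ : Measure ℝ) : Prop := ∃ φ : ℂ → ℂ, IsCGF φ τ μ

/-- `π` is a coupling of `F` and `G`. -/
def IsCoupling (π : Measure (ℝ × ℝ)) (F G : Measure ℝ) : Prop :=
  π.map Prod.fst = F ∧ π.map Prod.snd = G


lemma taylor_aux {S : Set ℂ} (hS : Convex ℝ S) {p0 p1 p2 p3 : ℂ → ℂ} {ε : ℝ} (hε : 0 ≤ ε)
    (h0 : ∀ z ∈ S, HasDerivAt p0 (p1 z) z) (h1 : ∀ z ∈ S, HasDerivAt p1 (p2 z) z)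
    (h2 : ∀ z ∈ S, HasDerivAt p2 (p3 z) z) (h3 : ∀ z ∈ S, ‖p3 z‖ ≤ ε)
    {w z : ℂ} (hw : w ∈ S) (hz : z ∈ S) :
    ‖p2 z - p2 w‖ ≤ ε * ‖z - w‖ ∧
    ‖p1 z - p1 w - p2 w * (z - w)‖ ≤ ε * ‖z - w‖ ^ 2 ∧
    ‖p0 z - p0 w - p1 w * (z - w) - p2 w * (z - w) ^ 2 / 2‖ ≤ ε * ‖z - w‖ ^ 3 := by
  have A : ∀ y ∈ S, ‖p2 y - p2 w‖ ≤ ε * ‖y - w‖ := fun y hy =>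
    hS.norm_image_sub_le_of_norm_hasDerivWithin_le
      (fun x hx => (h2 x hx).hasDerivWithinAt) h3 hw hy
  have B : ∀ y ∈ S, ‖p1 y - p1 w - p2 w * (y - w)‖ ≤ ε * ‖y - w‖ ^ 2 := by
    intro y hy
    have hsub : segment ℝ w y ⊆ S := hS.segment_subset hw hy
    have := (convex_segment (𝕜 := ℝ) w y).norm_image_sub_le_of_norm_hasDerivWithin_le
      (f := fun x => p1 x - p2 w * x) (f' := fun x => p2 x - p2 w) (C := ε * ‖y - w‖)
      (x := w) (y := y)
      (fun x hx => by
        have h := (h1 x (hsub hx)).sub ((hasDerivAt_id x).const_mul (p2 w))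
        refine (h.congr_deriv ?_).hasDerivWithinAt
        simp)
      (fun x hx => (A x (hsub hx)).trans
        (mul_le_mul_of_nonneg_left (norm_sub_le_of_mem_segment hx) hε))
      (left_mem_segment ℝ w y) (right_mem_segment ℝ w y)
    calc _ = ‖(p1 y - p2 w * y) - (p1 w - p2 w * w)‖ := by congr 1; ring
      _ ≤ _ := this
      _ = _ := by ring
  refine ⟨A z hz, B z hz, ?_⟩
  have hsub : segment ℝ w z ⊆ S := hS.segment_subset hw hz
  have := (convex_segment (𝕜 := ℝ) w z).norm_image_sub_le_of_norm_hasDerivWithin_le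
      (f := fun x => p0 x - p1 w * (x - w) - p2 w * (x - w) ^ 2 / 2)
      (f' := fun x => p1 x - p1 w - p2 w * (x - w)) (C := ε * ‖z - w‖ ^ 2)
      (x := w) (y := z)
      (fun x hx => by
        have hd : HasDerivAt (fun x : ℂ => x - w) 1 x := (hasDerivAt_id x).sub_const w
        have h := ((h0 x (hsub hx)).sub (hd.const_mul (p1 w))).sub
          (((hd.pow 2).const_mul (p2 w)).div_const 2)
        refine (h.congr_deriv ?_).hasDerivWithinAt
        simp; ring)
      (fun x hx => (B x (hsub hx)).trans (by
        have := norm_sub_le_of_mem_segment hx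
        gcongr))
      (left_mem_segment ℝ w z) (right_mem_segment ℝ w z)
  calc _ = _ := by congr 1; simp; ring
    _ ≤ _ := this
    _ = _ := by ring

lemma cgf_facts {φ : ℂ → ℂ} {ε : ℝ} {F : Measure ℝ} (hε : 0 < ε) [IsProbabilityMeasure F]
    (hm : (∫ x : ℝ, x ∂F) = 0) (hv : variance id F = 1) (h : IsCGF φ ε F) :
    deriv φ 0 = 0 ∧ deriv (deriv φ) 0 = 1 ∧
    ∀ t : ℝ, |t| * ε < 1 → (deriv φ t).im = 0 ∧ (deriv (deriv φ) t).im = 0 := by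
  obtain ⟨h00, hφ⟩ := h
  set M : ℕ → ℂ → ℂ := fun n z => ∫ x : ℝ, (x : ℂ) ^ n * Complex.exp (z * x) ∂F with hM
  have hopen : IsOpen {z : ℂ | ‖z‖ * ε < 1} :=
    isOpen_lt (continuous_norm.mul continuous_const) continuous_const
  have hopenR : IsOpen {t : ℝ | |t| * ε < 1} :=
    isOpen_lt (continuous_abs.mul continuous_const) continuous_const
  have hExpInt : ∀ z : ℂ, ‖z‖ * ε < 1 → z.re ∈ interior (integrableExpSet id F) := by
    intro z hz
    have hsub : {t : ℝ | |t| * ε < 1} ⊆ integrableExpSet id F := by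
      intro t ht
      have := (hφ t (by simpa using ht)).1.norm
      refine this.congr (Filter.Eventually.of_forall fun x => ?_)
      simp [Complex.norm_exp]
    refine interior_maximal hsub hopenR ?_
    exact lt_of_le_of_lt (mul_le_mul_of_nonneg_right (Complex.abs_re_le_norm z) hε.le) hz
  have hMd : ∀ n z, ‖z‖ * ε < 1 → HasDerivAt (M n) (M (n+1) z) z := fun n z hz =>
    hasDerivAt_integral_pow_mul_exp (hExpInt z hz) n
  have e0 : ∀ z, ‖z‖ * ε < 1 → Complex.exp (φ z) = M 0 z := by
    intro z hz; simpa [hM] using (hφ z hz).2.1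
  have e1 : ∀ z, ‖z‖ * ε < 1 → deriv φ z * Complex.exp (φ z) = M 1 z := by
    intro z hz
    have a := (hφ z hz).2.2.1.differentiableAt.hasDerivAt.cexp
    have b := (hMd 0 z hz).congr_of_eventuallyEq
      (Filter.eventually_of_mem (hopen.mem_nhds hz) e0)
    rw [mul_comm]; exact a.unique b
  have e2 : ∀ z, ‖z‖ * ε < 1 →
      (deriv (deriv φ) z + deriv φ z ^ 2) * Complex.exp (φ z) = M 2 z := by
    intro z hz
    have a0 := (hφ z hz).2.2.1.deriv.differentiableAt.hasDerivAt
    have a := a0.mul (hφ z hz).2.2.1.differentiableAt.hasDerivAt.cexp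
    have b := (hMd 1 z hz).congr_of_eventuallyEq
      (Filter.eventually_of_mem (hopen.mem_nhds hz) e1)
    rw [← a.unique b]; ring
  have hz0 : ‖(0:ℂ)‖ * ε < 1 := by simp
  have d1 : deriv φ 0 = 0 := by
    have := e1 0 hz0
    simp only [h00, Complex.exp_zero, mul_one, hM, pow_one, zero_mul] at this
    rw [this, integral_complex_ofReal, hm]; simp
  refine ⟨d1, ?_, ?_⟩
  · have := e2 0 hz0
    simp only [h00, Complex.exp_zero, mul_one, hM, zero_mul, d1] at this
    have h2 : ∫ x : ℝ, x ^ 2 ∂F = 1 := by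
      rw [← hv, variance_of_integral_eq_zero aemeasurable_id (by simpa using hm)]; simp
    have h3 : ∫ x : ℝ, (x : ℂ) ^ 2 ∂F = ((∫ x : ℝ, x ^ 2 ∂F : ℝ) : ℂ) := by
      rw [← integral_complex_ofReal]; simp
    rw [h3, h2] at this
    simpa using this
  · intro t ht
    have htz : ‖(t:ℂ)‖ * ε < 1 := by simpa using ht
    have hr : ∀ n, M n t = ((∫ x : ℝ, x ^ n * Real.exp (t * x) ∂F : ℝ) : ℂ) := by
      intro n; rw [← integral_complex_ofReal]; simp [hM]
    have i1 : deriv φ t = M 1 t / M 0 t := by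
      rw [← e1 t htz, ← e0 t htz]; field_simp [Complex.exp_ne_zero]
    have i2 : deriv (deriv φ) t = M 2 t / M 0 t - deriv φ t ^ 2 := by
      rw [← e2 t htz, ← e0 t htz]; field_simp [Complex.exp_ne_zero]; ring
    have j1 : (deriv φ t).im = 0 := by
      rw [i1, hr, hr, ← Complex.ofReal_div, Complex.ofReal_im]
    refine ⟨j1, ?_⟩
    rw [i2, i1, hr, hr, hr, ← Complex.ofReal_div, ← Complex.ofReal_div, ← Complex.ofReal_pow,
      ← Complex.ofReal_sub, Complex.ofReal_im]

/-- Existence of the saddle point. -/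
lemma saddle {φ : ℂ → ℂ} {ε : ℝ} {F : Measure ℝ} (hε : 0 < ε) [IsProbabilityMeasure F]
    (hm : (∫ x : ℝ, x ∂F) = 0) (hv : variance id F = 1) (h : IsCGF φ ε F)
    {x : ℝ} (hx : 2 ≤ x) (hx' : x * ε ≤ 1 / 5) :
    ∃ h v a : ℝ, 1 ≤ h ∧ h * ε ≤ 3 / 10 ∧ |x - h| ≤ ε * h ^ 2 ∧ |v - 1| ≤ ε * h ∧
      |a - h ^ 2 / 2| ≤ ε * h ^ 3 ∧
      Integrable (fun y : ℝ => Real.exp (h * y)) F ∧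
      (∫ y : ℝ, Real.exp (h * y) ∂F) = Real.exp a ∧
      ∀ t : ℝ, |t| * ε ≤ 1 / 10 → ∃ r : ℂ, ‖r‖ ≤ ε * |t| ^ 3 ∧
        (∫ y : ℝ, Complex.exp ((h + t * Complex.I) * y) ∂F) =
          Complex.exp (a + t * x * Complex.I - v * t ^ 2 / 2 + r) := by
  obtain ⟨d1, d2, dr⟩ := cgf_facts hε hm hv h
  obtain ⟨h00, hφ⟩ := h
  set S : Set ℂ := {z : ℂ | ‖z‖ * ε < 1} with hSdef
  have hS : Convex ℝ S := by
    have : S = Metric.ball 0 (1/ε) := by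
      ext z; rw [Metric.mem_ball, dist_zero_right, lt_div_iff₀ hε]; rfl
    rw [this]; exact convex_ball _ _
  have T : ∀ w z, w ∈ S → z ∈ S → _ := fun w z hw hz => taylor_aux hS (p0 := φ) (p1 := deriv φ)
    (p2 := deriv (deriv φ)) (p3 := iteratedDeriv 3 φ) hε.le
    (fun z hz => (hφ z hz).2.2.1.differentiableAt.hasDerivAt)
    (fun z hz => (hφ z hz).2.2.1.deriv.differentiableAt.hasDerivAt)
    (fun z hz => by
      rw [iteratedDeriv_succ, iteratedDeriv_succ, iteratedDeriv_one]
      exact (hφ z hz).2.2.1.deriv.deriv.differentiableAt.hasDerivAt)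
    (fun z hz => by simpa [hv] using (hφ z hz).2.2.2) (w := w) (z := z) hw hz
  have h0S : (0:ℂ) ∈ S := by simp [hSdef]
  have hrS : ∀ t : ℝ, |t| * ε < 1 → (t:ℂ) ∈ S := fun t ht => by simpa [hSdef] using ht
  have R1 : ∀ t : ℝ, |t| * ε < 1 → |(deriv φ t).re - t| ≤ ε * t ^ 2 := by
    intro t ht
    have := (T 0 t h0S (hrS t ht)).2.1
    rw [d1, d2] at this
    simp only [sub_zero, one_mul, Complex.norm_real, Real.norm_eq_abs, sq_abs] at this
    refine le_trans ?_ this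
    simpa using Complex.abs_re_le_norm (deriv φ t - t)
  set H : ℝ := 3 / 10 / ε with hH
  have hHε : H * ε = 3 / 10 := by rw [hH]; field_simp
  have hHpos : 0 < H := by positivity
  have hcont : ContinuousOn (fun t : ℝ => (deriv φ t).re) (Set.Icc 0 H) := by
    intro t ht
    have : |t| * ε < 1 := by
      rw [abs_of_nonneg ht.1]; nlinarith [ht.2]
    have hc := (hφ t (hrS t this)).2.2.1.deriv.differentiableAt.continuousAt
    exact (Complex.continuous_re.continuousAt.comp
      (ContinuousAt.comp (f := fun t : ℝ => (t:ℂ)) (x := t) hc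
        Complex.continuous_ofReal.continuousAt)).continuousWithinAt
  have hHx : x ≤ (deriv φ H).re := by
    have := (abs_le.1 (R1 H (by rw [abs_of_pos hHpos, hHε]; norm_num))).1
    have e : ε * H ^ 2 = 3 / 10 * H := by rw [← hHε]; ring
    have : x ≤ H * (7 / 10) := by
      rw [hH]; rw [← le_div_iff₀ hε] at hx'
      have : (1/5 / ε) ≤ 3 / 10 / ε * (7 / 10) := by
        rw [div_mul_eq_mul_div]; gcongr; norm_num
      linarith
    linarith
  obtain ⟨h, ⟨hh0, hhH⟩, hhx⟩ := intermediate_value_Icc hHpos.le hcont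
    (show x ∈ Set.Icc _ _ from ⟨by simp [d1]; linarith, hHx⟩)
  simp only at hhx
  have hhε : h * ε ≤ 3 / 10 := by rw [← hHε]; gcongr
  have habs : |h| * ε < 1 := by rw [abs_of_nonneg hh0]; linarith
  have hxh : |x - h| ≤ ε * h ^ 2 := by simpa [hhx] using R1 h habs
  have hd1 : deriv φ h = (x : ℂ) := Complex.ext (by simpa using hhx) (by simpa using (dr h habs).1)
  have hd2 : deriv (deriv φ) h = (((deriv (deriv φ) h).re : ℝ) : ℂ) :=
    Complex.ext (by simp) (by simpa using (dr h habs).2)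
  set v := (deriv (deriv φ) h).re with hvdef
  have hexp : ((∫ y : ℝ, Real.exp (h * y) ∂F : ℝ) : ℂ) = Complex.exp (φ h) := by
    rw [(hφ h (hrS h habs)).2.1, ← integral_complex_ofReal]; simp
  have hexpa : (∫ y : ℝ, Real.exp (h * y) ∂F) = Real.exp (φ h).re := by
    have := congrArg (fun z : ℂ => ‖z‖) hexp
    simp only [Complex.norm_real, Complex.norm_exp] at this
    rwa [Real.norm_of_nonneg (integral_nonneg fun _ => (Real.exp_pos _).le)] at this
  have h1le : 1 ≤ h := by
    have := (abs_le.1 hxh).2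
    nlinarith
  refine ⟨h, v, (φ h).re, h1le, hhε, hxh, ?_, ?_, ?_, hexpa, ?_⟩
  · have := (T 0 h h0S (hrS h habs)).1
    rw [d2, hd2, ← Complex.ofReal_one, ← Complex.ofReal_sub] at this
    rw [Complex.norm_real, sub_zero, Complex.norm_real, Real.norm_eq_abs, Real.norm_eq_abs,
      abs_of_nonneg hh0] at this
    exact this
  · have := (T 0 h h0S (hrS h habs)).2.2
    rw [d1, d2, h00] at this
    simp only [sub_zero, one_mul, zero_mul, Complex.norm_real, Real.norm_eq_abs,
      abs_of_nonneg hh0] at this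
    refine le_trans ?_ this
    have := Complex.abs_re_le_norm (φ h - (h:ℂ) ^ 2 / 2)
    have e : ((h:ℂ) ^ 2 / 2) = ((h ^ 2 / 2 : ℝ) : ℂ) := by push_cast; ring
    rw [Complex.sub_re, e, Complex.ofReal_re] at this
    rw [e]; exact this
  · have := (hφ h (hrS h habs)).1.norm
    refine this.congr (Filter.Eventually.of_forall fun y => ?_)
    simp [Complex.norm_exp]
  · intro t ht
    have hzS : (h + t * Complex.I : ℂ) ∈ S := by
      have : ‖(h + t * Complex.I : ℂ)‖ ≤ h + |t| := by
        refine (norm_add_le _ _).trans ?_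
        simp [abs_of_nonneg hh0]
      show _ * ε < 1
      nlinarith
    have := (T h (h + t * Complex.I) (hrS h habs) hzS).2.2
    rw [add_sub_cancel_left] at this
    refine ⟨_, this.trans_eq (by simp), ?_⟩
    rw [← (hφ _ hzS).2.1, hd1, hd2]
    have e1 : Complex.exp (φ h) = Complex.exp ((φ h).re : ℂ) := by
      rw [← hexp, hexpa, Complex.ofReal_exp]
    have e2 : φ (h + t * Complex.I) = φ h + (φ (h + t * Complex.I) - φ h) := by ring
    rw [e2, Complex.exp_add, e1, ← Complex.exp_add]
    congr 1
    ring_nf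
    simp only [Complex.I_sq]
    ring

open scoped FourierTransform in
lemma exists_kernel : ∃ k K : ℝ → ℂ, Continuous k ∧ (∀ t, 1 ≤ |t| → k t = 0) ∧ (∀ t, ‖k t‖ ≤ 1) ∧
    (∀ y, K y = ∫ t : ℝ, k t * Complex.exp ((-2 * Real.pi * t * y : ℝ) * Complex.I)) ∧
    Continuous K ∧ (∃ B, ∀ y, ‖K y‖ ≤ B) ∧ Integrable K ∧ (∫ y, K y) = 1 ∧
    Integrable (fun v => (|v| + Real.pi) ^ 2 * ‖K v‖) := by
  let f : ContDiffBump (0:ℝ) := ⟨1/2, 1, by norm_num, by norm_num⟩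
  have hs : HasCompactSupport (fun t : ℝ => ((f t : ℝ) : ℂ)) :=
    f.hasCompactSupport.comp_left (g := fun x : ℝ => (x:ℂ)) (by simp)
  have hc : ContDiff ℝ ((⊤ : ℕ∞) : WithTop ℕ∞) (fun t : ℝ => ((f t : ℝ) : ℂ)) :=
    Complex.ofRealCLM.contDiff.comp (g := Complex.ofRealCLM) (f := fun t : ℝ => f t) f.contDiff
  let g : SchwartzMap ℝ ℂ := hs.toSchwartzMap hc
  have hg : ∀ t, g t = ((f t : ℝ) : ℂ) := fun t => rfl
  refine ⟨g, (𝓕 g : SchwartzMap ℝ ℂ), g.continuous, ?_, ?_, ?_, (𝓕 g).continuous, ?_, (𝓕 g).integrable, ?_, ?_⟩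
  · intro t ht
    rw [hg, f.zero_of_le_dist (by simpa [f] using ht)]; simp
  · intro t
    rw [hg, Complex.norm_real, Real.norm_of_nonneg f.nonneg]; exact f.le_one
  · intro y
    rw [SchwartzMap.fourier_coe, Real.fourier_eq']
    congr 1; ext t
    simp only [smul_eq_mul]
    rw [mul_comm]; congr 3
    simp; ring
  · obtain ⟨B, hB⟩ := (𝓕 g).decay 0 0
    exact ⟨B, fun y => by simpa using hB.2 y⟩
  · have := congrArg (fun h : SchwartzMap ℝ ℂ => h 0) 
      (show (𝓕⁻ (𝓕 g : SchwartzMap ℝ ℂ) : SchwartzMap ℝ ℂ) = g from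
        FourierTransform.fourierInv_fourier_eq g)
    simp only [SchwartzMap.fourierInv_coe] at this
    rw [Real.fourierInv_eq'] at this
    simp only [inner_zero_right, mul_zero, Complex.ofReal_zero, zero_mul, Complex.exp_zero,
      one_smul] at this
    rw [this, hg, f.one_of_mem_closedBall (by simp [f])]; simp
  · have h0 := (𝓕 g).integrable_pow_mul volume 0
    have h1 := (𝓕 g).integrable_pow_mul volume 1
    have h2 := (𝓕 g).integrable_pow_mul volume 2
    refine ((h2.add (h1.const_mul (2 * Real.pi))).add (h0.const_mul (Real.pi ^ 2))).congr
      (Filter.Eventually.of_forall fun v => ?_)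
    simp only [Pi.add_apply, Real.norm_eq_abs]; ring

lemma fejer_aux (y : ℝ) (hy : y ≠ 0) :
    ∫ t in (0:ℝ)..1, 2 * (1 - t) * Real.cos (t * y) = 2 * (1 - Real.cos y) / y ^ 2 := by
  have hd : ∀ t ∈ Set.uIcc (0:ℝ) 1, HasDerivAt
      (fun t : ℝ => 2 * (1 - t) * (Real.sin (t * y) / y) - 2 * (Real.cos (t * y) / y ^ 2))
      (2 * (1 - t) * Real.cos (t * y)) t := by
    intro t _
    have a : HasDerivAt (fun t : ℝ => t * y) y t := by simpa using (hasDerivAt_id t).mul_const y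
    have b : HasDerivAt (fun t : ℝ => 2 * (1 - t)) (-2) t := by
      simpa using ((hasDerivAt_id t).const_sub 1).const_mul 2
    refine ((b.mul (a.sin.div_const y)).sub ((a.cos.div_const (y^2)).const_mul 2)).congr_deriv ?_
    field_simp; ring
  rw [intervalIntegral.integral_eq_sub_of_hasDerivAt hd
    (Continuous.intervalIntegrable (by fun_prop) _ _)]
  simp; ring

lemma fejer_zero (y : ℝ) (hy : y = 0) :
    ∫ t in (0:ℝ)..1, 2 * (1 - t) * Real.cos (t * y) = 1 := by
  have : ∀ t : ℝ, 2 * (1 - t) * Real.cos (t * y) = 2 - 2 * t := fun t => by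
    rw [hy, mul_zero, Real.cos_zero]; ring
  simp_rw [this]
  rw [intervalIntegral.integral_sub (by simp) (Continuous.intervalIntegrable (by fun_prop) _ _),
    intervalIntegral.integral_const_mul, integral_id]
  norm_num

lemma fejer_lower (y : ℝ) : 4 / (|y| + Real.pi) ^ 2 ≤
    ∫ t in (0:ℝ)..1, 2 * (1 - t) * (Real.cos (t * y) + Real.cos (t * (y - Real.pi))) := by
  have hpi := Real.pi_gt_three
  have e : ∫ t in (0:ℝ)..1, 2 * (1 - t) * (Real.cos (t * y) + Real.cos (t * (y - Real.pi))) =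
      (∫ t in (0:ℝ)..1, 2 * (1 - t) * Real.cos (t * y)) +
      ∫ t in (0:ℝ)..1, 2 * (1 - t) * Real.cos (t * (y - Real.pi)) := by
    rw [← intervalIntegral.integral_add (Continuous.intervalIntegrable (by fun_prop) _ _)
      (Continuous.intervalIntegrable (by fun_prop) _ _)]
    congr 1; ext t; ring
  rw [e]
  have hsmall : 4 / (|y| + Real.pi) ^ 2 ≤ 1 := by
    rw [div_le_one (by positivity)]
    nlinarith [abs_nonneg y]
  have hnn : ∀ z : ℝ, 0 ≤ 2 * (1 - Real.cos z) / z ^ 2 := fun z => by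
    have := Real.cos_le_one z
    have : 0 ≤ 1 - Real.cos z := by linarith
    positivity
  by_cases hy : y = 0
  · rw [fejer_zero y hy, fejer_aux _ (by rw [hy]; linarith)]
    have := hnn (y - Real.pi); linarith
  by_cases hy' : y - Real.pi = 0
  · rw [fejer_zero _ hy', fejer_aux _ hy]
    have := hnn y; linarith
  rw [fejer_aux _ hy, fejer_aux _ hy', Real.cos_sub_pi]
  have h1 : y ^ 2 ≤ (|y| + Real.pi) ^ 2 := by
    rw [← sq_abs y]; gcongr; linarith
  have h2 : (y - Real.pi) ^ 2 ≤ (|y| + Real.pi) ^ 2 := by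
    rw [← sq_abs (y - Real.pi)]; gcongr
    refine (abs_sub _ _).trans ?_
    rw [abs_of_pos Real.pi_pos]
  have p1 : 0 < y ^ 2 := by positivity
  have p2 : 0 < (y - Real.pi) ^ 2 := by positivity
  have c1 := Real.cos_le_one y
  have c2 := Real.neg_one_le_cos y
  calc 4 / (|y| + Real.pi) ^ 2 = 2 * (1 - Real.cos y) / (|y| + Real.pi) ^ 2
        + 2 * (1 - -Real.cos y) / (|y| + Real.pi) ^ 2 := by ring
    _ ≤ _ := by
      refine add_le_add (div_le_div_of_nonneg_left ?_ p1 h1) (div_le_div_of_nonneg_left ?_ p2 h2)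
      · linarith
      · linarith

lemma re_charFun_shift (P : Measure ℝ) [IsProbabilityMeasure P] (t c : ℝ) :
    ∫ y, Real.cos (t * (y - c)) ∂P ≤ ‖charFun P t‖ := by
  have e : ((∫ y, Complex.exp ((t * (y - c) : ℝ) * Complex.I) ∂P)) =
      charFun P t * Complex.exp ((-(t * c) : ℝ) * Complex.I) := by
    rw [charFun_apply_real, ← integral_mul_const]
    congr 1; ext y; rw [← Complex.exp_add]; congr 1; push_cast; ring
  have hi : Integrable (fun y : ℝ => Complex.exp ((t * (y - c) : ℝ) * Complex.I)) P := by
    refine Integrable.of_bound (C := 1) (by fun_prop) (Filter.Eventually.of_forall fun y => ?_)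
    rw [Complex.norm_exp_ofReal_mul_I]
  have e2 : ∫ y, Real.cos (t * (y - c)) ∂P =
      (∫ y, Complex.exp ((t * (y - c) : ℝ) * Complex.I) ∂P).re := by
    have := integral_re hi
    simp only [RCLike.re_to_complex, Complex.exp_ofReal_mul_I_re] at this
    exact this
  rw [e2, e]
  refine (Complex.re_le_norm _).trans ?_
  rw [norm_mul, Complex.norm_exp_ofReal_mul_I, mul_one]

lemma conc (P : Measure ℝ) [IsProbabilityMeasure P] :
    ∫ y, 4 / (|y| + Real.pi) ^ 2 ∂P ≤ 4 * ∫ t in (0:ℝ)..1, ‖charFun P t‖ := by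
  have hpi := Real.pi_pos
  let G : ℝ → ℝ → ℝ := fun y t =>
    2 * (1 - t) * (Real.cos (t * y) + Real.cos (t * (y - Real.pi)))
  have hG : Integrable (Function.uncurry G) (P.prod (volume.restrict (Set.Ioc (0:ℝ) 1))) := by
    refine Integrable.of_bound (C := 4) (by
      have : Continuous (Function.uncurry G) := by
        simp only [G, Function.uncurry_def]; fun_prop
      exact this.aestronglyMeasurable) ?_
    have : ∀ᵐ p ∂(P.prod (volume.restrict (Set.Ioc (0:ℝ) 1))), p.2 ∈ Set.Ioc (0:ℝ) 1 := by
      refine Measure.quasiMeasurePreserving_snd.ae ?_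
      exact ae_restrict_mem measurableSet_Ioc
    filter_upwards [this] with p hp
    simp only [G, Function.uncurry_def, norm_mul, Real.norm_eq_abs]
    have a1 : |1 - p.2| ≤ 1 := by rw [abs_le]; constructor <;> linarith [hp.1, hp.2]
    have a2 : |Real.cos (p.2 * p.1) + Real.cos (p.2 * (p.1 - Real.pi))| ≤ 2 := by
      refine (abs_add_le _ _).trans ?_
      linarith [Real.abs_cos_le_one (p.2 * p.1), Real.abs_cos_le_one (p.2 * (p.1 - Real.pi))]
    rw [abs_of_pos (by norm_num : (0:ℝ) < 2)]
    nlinarith [abs_nonneg (1 - p.2), abs_nonneg (Real.cos (p.2 * p.1) + Real.cos (p.2 * (p.1 - Real.pi)))]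
  have hic : ∀ c t : ℝ, Integrable (fun y => Real.cos (t * (y - c))) P := fun c t => by
    refine Integrable.of_bound (C := 1) (by fun_prop) (Filter.Eventually.of_forall fun y => ?_)
    exact Real.abs_cos_le_one _
  calc ∫ y, 4 / (|y| + Real.pi) ^ 2 ∂P ≤ ∫ y, (∫ t in Set.Ioc (0:ℝ) 1, G y t) ∂P := by
        refine integral_mono ?_ hG.integral_prod_left (fun y => ?_)
        · refine Integrable.of_bound (C := 4 / Real.pi ^ 2) (by
            have : Measurable (fun y : ℝ => 4 / (|y| + Real.pi) ^ 2) := by fun_prop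
            exact this.aestronglyMeasurable) (Filter.Eventually.of_forall fun y => ?_)
          rw [Real.norm_of_nonneg (by positivity)]
          gcongr
          linarith [abs_nonneg y]
        · have := fejer_lower y
          rwa [intervalIntegral.integral_of_le zero_le_one] at this
    _ = ∫ t in Set.Ioc (0:ℝ) 1, (∫ y, G y t ∂P) := integral_integral_swap hG
    _ ≤ ∫ t in Set.Ioc (0:ℝ) 1, 4 * ‖charFun P t‖ := by
        refine setIntegral_mono_on hG.integral_prod_right ?_ measurableSet_Ioc (fun t ht => ?_)
        · exact ((intervalIntegrable_charFun (a := 0) (b := 1)).norm.1).const_mul 4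
        · simp only [G]
          rw [integral_const_mul, integral_add (by simpa using hic 0 t) (hic _ t)]
          have a := re_charFun_shift P t 0
          have b := re_charFun_shift P t Real.pi
          simp only [sub_zero] at a
          have : 0 ≤ 1 - t := by linarith [ht.2]
          have c := norm_nonneg (charFun P t)
          calc _ ≤ 2 * (1 - t) * (‖charFun P t‖ + ‖charFun P t‖) := by gcongr
            _ ≤ _ := by nlinarith [ht.1]
    _ = _ := by rw [integral_const_mul, intervalIntegral.integral_of_le zero_le_one]

/-- The truncated exponential. -/
def uf (b y : ℝ) : ℝ := if 0 < y then Real.exp (-(b * y)) else 0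

lemma uf_nonneg (b y : ℝ) : 0 ≤ uf b y := by
  unfold uf; split_ifs
  · positivity
  · exact le_rfl

lemma uf_le_one {b : ℝ} (hb : 0 ≤ b) (y : ℝ) : uf b y ≤ 1 := by
  unfold uf; split_ifs with h
  · rw [Real.exp_le_one_iff]; nlinarith
  · norm_num

lemma measurable_uf (b : ℝ) : Measurable (uf b) := by
  unfold uf
  exact Measurable.ite measurableSet_Ioi (by fun_prop) measurable_const

lemma uf_eq_indicator (b : ℝ) :
    uf b = Set.indicator (Set.Ioi 0) (fun y => Real.exp (-b * y)) := by
  ext y; simp [uf, Set.indicator_apply]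

lemma integrable_uf_volume {b : ℝ} (hb : 0 < b) : Integrable (uf b) := by
  rw [uf_eq_indicator, integrable_indicator_iff measurableSet_Ioi]
  exact exp_neg_integrableOn_Ioi 0 hb

lemma integral_uf_volume {b : ℝ} (hb : 0 < b) : ∫ y, uf b y = 1 / b := by
  rw [uf_eq_indicator, integral_indicator measurableSet_Ioi,
    integral_exp_mul_Ioi (by linarith) 0]
  simp

lemma integrable_uf {b : ℝ} (hb : 0 ≤ b) (P : Measure ℝ) [IsFiniteMeasure P] :
    Integrable (uf b) P :=
  Integrable.of_bound (C := 1) (measurable_uf b).aestronglyMeasurable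
    (Filter.Eventually.of_forall fun y => by
      rw [Real.norm_of_nonneg (uf_nonneg b y)]; exact uf_le_one hb y)

lemma uf_lip {b : ℝ} (hb : 0 ≤ b) (y z : ℝ) (hy : 0 < y) (hz : 0 < z) :
    |uf b y - uf b z| ≤ b * |y - z| := by
  have key : ∀ y z : ℝ, 0 < y → y ≤ z →
      Real.exp (-(b * y)) - Real.exp (-(b * z)) ≤ b * (z - y) := by
    intro y z hy hyz
    have h1 : Real.exp (-(b * y)) ≤ 1 := by rw [Real.exp_le_one_iff]; nlinarith
    have h2 := Real.add_one_le_exp (-(b * (z - y)))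
    have h3 : Real.exp (-(b * z)) = Real.exp (-(b * y)) * Real.exp (-(b * (z - y))) := by
      rw [← Real.exp_add]; congr 1; ring
    have h4 : 0 ≤ b * (z - y) := mul_nonneg hb (by linarith)
    rw [h3]
    nlinarith [Real.exp_pos (-(b * y))]
  have mono : ∀ y z : ℝ, y ≤ z → Real.exp (-(b * z)) ≤ Real.exp (-(b * y)) := by
    intro y z h; rw [Real.exp_le_exp]; nlinarith
  simp only [uf, hy, hz, if_true]
  rcases le_total y z with h | h
  · rw [abs_of_nonneg (by linarith [mono y z h]), abs_of_nonpos (by linarith : y - z ≤ 0)]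
    have := key y z hy h; linarith
  · rw [abs_of_nonpos (by linarith [mono z y h]), abs_of_nonneg (by linarith : 0 ≤ y - z)]
    have := key z y hz h; linarith

lemma uf_diff {b : ℝ} (hb : 0 ≤ b) (y v : ℝ) :
    |uf b y - uf b (y - v)| ≤ (b + 4 / (|y| + Real.pi) ^ 2) * (|v| + Real.pi) ^ 2 := by
  have hpi := Real.pi_gt_three
  have hy0 := abs_nonneg y
  have hv0 := abs_nonneg v
  have hX : 0 ≤ 4 / (|y| + Real.pi) ^ 2 * (|v| + Real.pi) ^ 2 := by positivity
  have hY : 0 ≤ b * (|v| + Real.pi) ^ 2 := by positivity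
  rw [add_mul]
  by_cases h : |y| ≤ |v|
  · have h1 : |uf b y - uf b (y - v)| ≤ 1 := by
      rw [abs_le]
      constructor <;> linarith [uf_nonneg b y, uf_nonneg b (y-v), uf_le_one hb y, uf_le_one hb (y-v)]
    have h2 : 1 ≤ 4 / (|y| + Real.pi) ^ 2 * (|v| + Real.pi) ^ 2 := by
      rw [div_mul_eq_mul_div, one_le_div (by positivity)]
      have : (|y| + Real.pi) ^ 2 ≤ (|v| + Real.pi) ^ 2 := by gcongr
      nlinarith
    linarith
  · push Not at h
    rcases lt_or_ge 0 y with hy | hy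
    · have : 0 < y - v := by
        rw [abs_of_pos hy] at h; linarith [le_abs_self v]
      have := uf_lip hb y (y - v) hy this
      rw [sub_sub_cancel] at this
      have h3 : b * |v| ≤ b * (|v| + Real.pi) ^ 2 := by
        gcongr; nlinarith
      linarith
    · have : ¬ (0 < y - v) := by
        rw [abs_of_nonpos hy] at h; linarith [neg_abs_le v]
      simp only [uf, not_lt.2 hy, this, if_false, sub_zero, abs_zero]
      linarith

lemma smoothing : ∃ C : ℝ, 0 < C ∧ ∀ (P Q : Measure ℝ), IsProbabilityMeasure P →
    IsProbabilityMeasure Q → ∀ b : ℝ, 0 < b →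
    |(∫ y, uf b y ∂P) - ∫ y, uf b y ∂Q| ≤ C * (b + (∫ t in (0:ℝ)..1, ‖charFun P t‖) +
      (∫ t in (0:ℝ)..1, ‖charFun Q t‖) +
      1 / b * ∫ t in (-(2 * Real.pi))..(2 * Real.pi), ‖charFun P t - charFun Q t‖) := by
  obtain ⟨k, K, hkc, hk0, hk1, hK, hKc, ⟨B, hB⟩, hKi, hK1, hKw⟩ := exists_kernel
  have hpi := Real.pi_gt_three
  set C1 : ℝ := ∫ v, (|v| + Real.pi) ^ 2 * ‖K v‖ with hC1
  have hC1n : 0 ≤ C1 := integral_nonneg fun v => by positivity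
  have hki : Integrable k := by
    refine hkc.integrable_of_hasCompactSupport ?_
    refine HasCompactSupport.intro (isCompact_Icc (a := (-1:ℝ)) (b := 1)) (fun t ht => hk0 t ?_)
    by_contra hlt
    push Not at hlt
    exact ht (abs_le.1 hlt.le)
  refine ⟨8 * C1 + 1, by positivity, ?_⟩
  intro P Q hP hQ b hb
  let us : ℝ → ℂ := fun y => ∫ w, (uf b w : ℂ) * K (y - w)
  have hui : Integrable (fun w => (uf b w : ℂ)) := (integrable_uf_volume hb).ofReal
  have S1 : ∀ y, ‖(uf b y : ℂ) - us y‖ ≤ C1 * (b + 4 / (|y| + Real.pi) ^ 2) := by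
    intro y
    have e1 : us y = ∫ v, (uf b (y - v) : ℂ) * K v := by
      have := integral_sub_left_eq_self (fun v => (uf b (y - v) : ℂ) * K v) volume y
      simp only [sub_sub_cancel] at this
      exact this
    have i1 : Integrable (fun v => (uf b (y - v) : ℂ) * K v) := by
      refine hKi.bdd_mul (c := 1) ?_ (Filter.Eventually.of_forall fun v => ?_)
      · exact (Complex.measurable_ofReal.comp
          ((measurable_uf b).comp (measurable_const.sub measurable_id))).aestronglyMeasurable
      · rw [Complex.norm_real, Real.norm_of_nonneg (uf_nonneg _ _)]; exact uf_le_one hb.le _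
    have e2 : (uf b y : ℂ) = ∫ v, (uf b y : ℂ) * K v := by
      rw [integral_const_mul, hK1, mul_one]
    rw [e1, e2, ← integral_sub (hKi.const_mul _) i1]
    refine (norm_integral_le_of_norm_le (hKw.const_mul (b + 4 / (|y| + Real.pi) ^ 2))
      (Filter.Eventually.of_forall fun v => ?_)).trans_eq ?_
    · rw [← sub_mul, norm_mul, ← Complex.ofReal_sub, Complex.norm_real, Real.norm_eq_abs,
        ← mul_assoc]
      exact mul_le_mul_of_nonneg_right (uf_diff hb.le y v) (norm_nonneg _)
    · rw [integral_const_mul, mul_comm]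
  have S2i : ∀ (P : Measure ℝ) [IsProbabilityMeasure P],
      Integrable (Function.uncurry fun y w => (uf b w : ℂ) * K (y - w)) (P.prod volume) := by
    intro P _
    refine Integrable.mono' (g := fun p : ℝ × ℝ => uf b p.2 * B)
      (((integrable_uf_volume hb).comp_snd P).mul_const B) ?_
      (Filter.Eventually.of_forall fun p => ?_)
    · refine Measurable.aestronglyMeasurable ?_
      refine Measurable.mul ?_ ?_
      · exact Complex.measurable_ofReal.comp ((measurable_uf b).comp measurable_snd)
      · exact hKc.measurable.comp (measurable_fst.sub measurable_snd)
    · simp only [Function.uncurry_def, norm_mul, Complex.norm_real]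
      rw [Real.norm_of_nonneg (uf_nonneg _ _)]
      exact mul_le_mul_of_nonneg_left (hB _) (uf_nonneg _ _)
  have S2 : ∀ (P : Measure ℝ) [IsProbabilityMeasure P],
      ∫ y, us y ∂P = ∫ w, (uf b w : ℂ) * ∫ y, K (y - w) ∂P := by
    intro P _
    simp only [us]
    rw [integral_integral_swap (S2i P)]
    congr 1; ext w
    rw [integral_const_mul]
  have S3 : ∀ (P : Measure ℝ) [IsProbabilityMeasure P] (w : ℝ), ∫ y, K (y - w) ∂P =
      ∫ t, k t * Complex.exp ((2 * Real.pi * t * w : ℝ) * Complex.I) *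
        charFun P (-(2 * Real.pi) * t) := by
    intro P _ w
    simp_rw [hK]
    rw [integral_integral_swap]
    · congr 1; ext t
      rw [charFun_apply_real, ← integral_const_mul]
      congr 1; ext y
      rw [mul_assoc (k t) (Complex.exp _) (Complex.exp _), ← Complex.exp_add]
      congr 2; push_cast; ring
    · refine Integrable.mono' (g := fun p : ℝ × ℝ => ‖k p.2‖)
        (hki.norm.comp_snd P) ?_ (Filter.Eventually.of_forall fun p => ?_)
      · refine Continuous.aestronglyMeasurable ?_
        simp only [Function.uncurry_def]
        exact (hkc.comp continuous_snd).mul (by fun_prop)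
      · simp only [Function.uncurry_def]
        rw [norm_mul, Complex.norm_exp_ofReal_mul_I, mul_one]
  set E : ℝ := ∫ t in (-(2 * Real.pi))..(2 * Real.pi), ‖charFun P t - charFun Q t‖ with hE
  have hEn : 0 ≤ E := intervalIntegral.integral_nonneg (by linarith) fun t _ => norm_nonneg _
  have S3i : ∀ (P : Measure ℝ) [IsProbabilityMeasure P] (w : ℝ), Integrable (fun t : ℝ =>
      k t * Complex.exp ((2 * Real.pi * t * w : ℝ) * Complex.I) *
        charFun P (-(2 * Real.pi) * t)) := by
    intro P _ w
    refine Integrable.mono' (g := fun t => ‖k t‖) hki.norm ?_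
      (Filter.Eventually.of_forall fun t => ?_)
    · refine Measurable.aestronglyMeasurable ?_
      refine Measurable.mul ?_ (measurable_charFun.comp (by fun_prop))
      exact Continuous.measurable (hkc.mul (by fun_prop))
    · rw [norm_mul, norm_mul, Complex.norm_exp_ofReal_mul_I, mul_one]
      exact mul_le_of_le_one_right (norm_nonneg _) (norm_charFun_le_one _)
  have S4 : ∀ w, ‖(∫ y, K (y - w) ∂P) - ∫ y, K (y - w) ∂Q‖ ≤ E := by
    intro w
    rw [S3 P w, S3 Q w, ← integral_sub (S3i P w) (S3i Q w)]
    have hii : IntervalIntegrable (fun t => ‖charFun P t - charFun Q t‖) volume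
        (2 * Real.pi) (-(2 * Real.pi)) :=
      (intervalIntegrable_charFun.sub intervalIntegrable_charFun).norm
    have hii2 : IntervalIntegrable (fun t => ‖charFun P (-(2 * Real.pi) * t)
        - charFun Q (-(2 * Real.pi) * t)‖) volume (-1) 1 := by
      have := hii.comp_mul_left (c := -(2 * Real.pi))
      have e1 : 2 * Real.pi / (-(2 * Real.pi)) = -1 := by field_simp
      have e2 : -(2 * Real.pi) / (-(2 * Real.pi)) = 1 := by field_simp
      rwa [e1, e2] at this
    have hset : IntegrableOn (fun t => ‖charFun P (-(2 * Real.pi) * t)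
        - charFun Q (-(2 * Real.pi) * t)‖) (Set.Ioc (-1) 1) := hii2.1
    refine (norm_integral_le_of_norm_le (hset.integrable_indicator measurableSet_Ioc)
      (Filter.Eventually.of_forall fun t => ?_)).trans ?_
    · rw [← mul_sub, norm_mul, norm_mul, Complex.norm_exp_ofReal_mul_I, mul_one]
      by_cases ht : t ∈ Set.Ioc (-1:ℝ) 1
      · rw [Set.indicator_of_mem ht]
        exact mul_le_of_le_one_left (norm_nonneg _) (hk1 t)
      · rw [Set.indicator_of_notMem ht, hk0 t, norm_zero, zero_mul]
        by_contra hlt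
        push Not at hlt
        rw [abs_lt] at hlt
        exact ht ⟨hlt.1, hlt.2.le⟩
    · rw [integral_indicator measurableSet_Ioc,
        ← intervalIntegral.integral_of_le (by norm_num : (-1:ℝ) ≤ 1),
        intervalIntegral.integral_comp_mul_left (fun t => ‖charFun P t - charFun Q t‖)
          (by linarith : -(2 * Real.pi) ≠ 0)]
      have : -(2 * Real.pi) * (-1) = 2 * Real.pi := by ring
      rw [this, mul_one, intervalIntegral.integral_symm, ← hE, smul_eq_mul, inv_neg,
        neg_mul_neg]
      have : (2 * Real.pi)⁻¹ ≤ 1 := inv_le_one_of_one_le₀ (by linarith)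
      exact mul_le_of_le_one_left hEn this
  have S5 : ‖(∫ y, us y ∂P) - ∫ y, us y ∂Q‖ ≤ 1 / b * E := by
    have hExpInt : ∀ (P : Measure ℝ) [IsProbabilityMeasure P],
        Integrable (fun w => (uf b w : ℂ) * ∫ y, K (y - w) ∂P) := by
      intro P _
      have := (S2i P).integral_prod_right
      refine this.congr (Filter.Eventually.of_forall fun w => ?_)
      simp only [Function.uncurry_def]
      rw [integral_const_mul]
    rw [S2 P, S2 Q, ← integral_sub (hExpInt P) (hExpInt Q)]
    refine (norm_integral_le_of_norm_le ((integrable_uf_volume hb).mul_const E)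
      (Filter.Eventually.of_forall fun w => ?_)).trans_eq ?_
    · rw [← mul_sub, norm_mul, Complex.norm_real, Real.norm_of_nonneg (uf_nonneg _ _)]
      exact mul_le_mul_of_nonneg_left (S4 w) (uf_nonneg _ _)
    · rw [integral_mul_const, integral_uf_volume hb]
  have S6 : ∀ (P : Measure ℝ) [IsProbabilityMeasure P],
      ‖((∫ y, uf b y ∂P : ℝ) : ℂ) - ∫ y, us y ∂P‖ ≤
        C1 * (b + 4 * ∫ t in (0:ℝ)..1, ‖charFun P t‖) := by
    intro P _
    have hD : Integrable (fun y : ℝ => 4 / (|y| + Real.pi) ^ 2) P := by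
      refine Integrable.of_bound (C := 4 / Real.pi ^ 2) (by
        have : Measurable (fun y : ℝ => 4 / (|y| + Real.pi) ^ 2) := by fun_prop
        exact this.aestronglyMeasurable) (Filter.Eventually.of_forall fun y => ?_)
      rw [Real.norm_of_nonneg (by positivity)]
      gcongr
      linarith [abs_nonneg y]
    have hur : Integrable (fun y => ((uf b y : ℝ) : ℂ)) P := (integrable_uf hb.le P).ofReal
    have husi : Integrable us P := (S2i P).integral_prod_left
    rw [← integral_complex_ofReal, ← integral_sub hur husi]
    refine (norm_integral_le_of_norm_le (((integrable_const b).add hD).const_mul C1)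
      (Filter.Eventually.of_forall S1)).trans ?_
    rw [integral_const_mul]
    simp only [Pi.add_apply]
    rw [integral_add (integrable_const b) hD]
    simp only [integral_const, probReal_univ, one_smul]
    have := conc P
    gcongr
  have s1 := S6 P
  have s2 := S6 Q
  set a1 := ∫ t in (0:ℝ)..1, ‖charFun P t‖
  set a2 := ∫ t in (0:ℝ)..1, ‖charFun Q t‖
  have hA1 : 0 ≤ a1 := intervalIntegral.integral_nonneg (by norm_num) fun t _ => norm_nonneg _
  have hA2 : 0 ≤ a2 := intervalIntegral.integral_nonneg (by norm_num) fun t _ => norm_nonneg _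
  rw [← Real.norm_eq_abs, ← Complex.norm_real, Complex.ofReal_sub]
  set A : ℂ := ((∫ y, uf b y ∂P : ℝ) : ℂ)
  set A' : ℂ := ((∫ y, uf b y ∂Q : ℝ) : ℂ)
  set U := ∫ y, us y ∂P
  set U' := ∫ y, us y ∂Q
  have tri : ‖A - A'‖ ≤ ‖A - U‖ + ‖U - U'‖ + ‖A' - U'‖ := by
    have : A - A' = (A - U) + (U - U') - (A' - U') := by ring
    rw [this]
    exact (norm_sub_le _ _).trans (add_le_add_left (norm_add_le _ _) _)
  have hE1 : 0 ≤ 1 / b * E := by positivity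
  calc _ ≤ _ := tri
    _ ≤ C1 * (b + 4 * a1) + 1 / b * E + C1 * (b + 4 * a2) := by gcongr
    _ ≤ _ := by
      nlinarith [mul_nonneg hC1n hb.le, mul_nonneg hC1n hA1, mul_nonneg hC1n hA2,
        mul_nonneg hC1n hE1]

lemma integrable_g3 : Integrable (fun s : ℝ => |s| ^ 3 * Real.exp (-s ^ 2 / 4)) := by
  have := (integrable_rpow_mul_exp_neg_mul_sq (b := 1/4) (by norm_num) (s := 3) (by norm_num)).norm
  refine this.congr (Filter.Eventually.of_forall fun s => ?_)
  simp only
  have e : s ^ (3:ℝ) = s ^ 3 := by exact_mod_cast Real.rpow_natCast s 3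
  rw [e, norm_mul, Real.norm_eq_abs, abs_pow, Real.norm_of_nonneg (Real.exp_pos _).le]
  congr 2; ring

lemma integrable_g0 : Integrable (fun s : ℝ => Real.exp (-s ^ 2 / 4)) := by
  refine (integrable_exp_neg_mul_sq (b := 1/4) (by norm_num)).congr
    (Filter.Eventually.of_forall fun s => ?_)
  simp only; congr 1; ring

lemma interval_bound {f g : ℝ → ℝ} {a b : ℝ} (hab : a ≤ b) (hf : IntervalIntegrable f volume a b)
    (hg : Integrable g) (hg0 : ∀ x, 0 ≤ g x) (h : ∀ x ∈ Set.Icc a b, f x ≤ g x) :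
    ∫ x in a..b, f x ≤ ∫ x, g x := by
  refine (intervalIntegral.integral_mono_on hab hf hg.intervalIntegrable h).trans ?_
  rw [intervalIntegral.integral_of_le hab]
  exact setIntegral_le_integral hg (Filter.Eventually.of_forall hg0)

lemma uf_scale {c : ℝ} (hc : 0 < c) (β y : ℝ) : uf (β / c) (c * y) = uf β y := by
  unfold uf
  have : 0 < c * y ↔ 0 < y := by constructor <;> intro h
                                 · exact pos_of_mul_pos_right h hc.le
                                 · positivity
  simp only [this]
  congr 2; field_simp

lemma compare_gauss : ∃ C : ℝ, 0 < C ∧ ∀ (P : Measure ℝ), IsProbabilityMeasure P →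
    ∀ (ε v β : ℝ), 0 < ε → 7 / 10 ≤ v → 1 ≤ β →
    (∀ t : ℝ, |t| * ε ≤ 1 / 10 → ∃ r : ℂ, ‖r‖ ≤ ε * |t| ^ 3 ∧
      charFun P t = Complex.exp (-v * t ^ 2 / 2 + r)) →
    |(∫ y, uf β y ∂P) - ∫ y, uf β y ∂(gaussianReal 0 v.toNNReal)| ≤ C * (ε * β) := by
  obtain ⟨C, hC, hsm⟩ := smoothing
  have hpi := Real.pi_pos
  set G0 : ℝ := ∫ s : ℝ, Real.exp (-s ^ 2 / 4) with hG0
  set G3 : ℝ := ∫ s : ℝ, |s| ^ 3 * Real.exp (-s ^ 2 / 4) with hG3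
  have G0n : 0 ≤ G0 := integral_nonneg fun s => (Real.exp_pos _).le
  have G3n : 0 ≤ G3 := integral_nonneg fun s => by positivity
  refine ⟨C * (20 * Real.pi + 40 * Real.pi * G0 + G3), by positivity, ?_⟩
  intro P hP ε v β hε hv hβ hch
  have hv0 : 0 ≤ v := by linarith
  set Q := gaussianReal 0 v.toNNReal with hQ
  have hQc : ∀ t : ℝ, charFun Q t = Complex.exp (-v * t ^ 2 / 2) := by
    intro t
    rw [hQ, charFun_gaussianReal]
    congr 1
    have : ((v.toNNReal : ℝ) : ℂ) = v := by rw [Real.coe_toNNReal v hv0]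
    simp only [Complex.ofReal_zero, mul_zero, zero_mul, zero_sub]
    rw [this]; ring
  set c : ℝ := 1 / (20 * Real.pi * ε) with hc
  have hcpos : 0 < c := by positivity
  have hcε : 2 * Real.pi * c * ε = 1 / 10 := by rw [hc]; field_simp; norm_num
  have hcinv : c⁻¹ = 20 * Real.pi * ε := by rw [hc]; field_simp
  have small : ∀ s : ℝ, |s| * ε ≤ 1 / 10 → ε * |s| ^ 3 ≤ s ^ 2 / 10 := by
    intro s hs
    have : ε * |s| ^ 3 = (|s| * ε) * |s| ^ 2 := by ring
    rw [this, sq_abs]; nlinarith [sq_nonneg s]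
  have bP : ∀ s : ℝ, |s| * ε ≤ 1 / 10 → ‖charFun P s‖ ≤ Real.exp (-s ^ 2 / 4) := by
    intro s hs
    obtain ⟨r, hr, e⟩ := hch s hs
    rw [e, Complex.norm_exp, Real.exp_le_exp]
    have h1 : (-v * s ^ 2 / 2 + r : ℂ).re = -v * s ^ 2 / 2 + r.re := by
      rw [Complex.add_re]; congr 1
      have : (-v * s ^ 2 / 2 : ℂ) = ((-v * s ^ 2 / 2 : ℝ) : ℂ) := by push_cast; ring
      rw [this, Complex.ofReal_re]
    rw [h1]
    have := Complex.re_le_norm r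
    have := small s hs
    nlinarith [sq_nonneg s]
  have bQ : ∀ s : ℝ, ‖charFun Q s‖ ≤ Real.exp (-s ^ 2 / 4) := by
    intro s
    have : (-v * s ^ 2 / 2 : ℂ) = ((-v * s ^ 2 / 2 : ℝ) : ℂ) := by push_cast; ring
    rw [hQc, this, Complex.norm_exp_ofReal, Real.exp_le_exp]
    nlinarith [sq_nonneg s]
  have bD : ∀ s : ℝ, |s| * ε ≤ 1 / 10 →
      ‖charFun P s - charFun Q s‖ ≤ ε * (|s| ^ 3 * Real.exp (-s ^ 2 / 4)) := by
    intro s hs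
    obtain ⟨r, hr, e⟩ := hch s hs
    have hr2 := Complex.norm_exp_sub_sum_le_norm_mul_exp r 1
    simp only [Finset.range_one, Finset.sum_singleton, pow_zero, Nat.factorial_zero, Nat.cast_one,
      div_one, pow_one] at hr2
    have e3 : (-v * s ^ 2 / 2 : ℂ) = ((-v * s ^ 2 / 2 : ℝ) : ℂ) := by push_cast; ring
    rw [e, hQc, Complex.exp_add]
    calc ‖Complex.exp (-v * s ^ 2 / 2) * Complex.exp r - Complex.exp (-v * s ^ 2 / 2)‖
        = ‖Complex.exp (-v * s ^ 2 / 2) * (Complex.exp r - 1)‖ := by congr 1; ring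
      _ ≤ Real.exp (-v * s ^ 2 / 2) * (‖r‖ * Real.exp ‖r‖) := by
        rw [norm_mul, e3, Complex.norm_exp_ofReal]; gcongr
      _ = ‖r‖ * Real.exp (-v * s ^ 2 / 2 + ‖r‖) := by rw [Real.exp_add]; ring
      _ ≤ (ε * |s| ^ 3) * Real.exp (-s ^ 2 / 4) := by
        have := small s hs
        gcongr
        nlinarith [sq_nonneg s]
      _ = _ := by ring
  have hmeas : Measurable (fun y : ℝ => c * y) := by fun_prop
  have hP' : IsProbabilityMeasure (P.map (fun y => c * y)) :=
    Measure.isProbabilityMeasure_map hmeas.aemeasurable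
  have hQ' : IsProbabilityMeasure (Q.map (fun y => c * y)) :=
    Measure.isProbabilityMeasure_map hmeas.aemeasurable
  have key := hsm (P.map (fun y => c * y)) (Q.map (fun y => c * y)) hP' hQ' (β / c) (by positivity)
  have eI : ∀ P : Measure ℝ, ∫ y, uf (β / c) y ∂(P.map (fun y => c * y)) = ∫ y, uf β y ∂P := by
    intro P
    rw [integral_map hmeas.aemeasurable (measurable_uf _).aestronglyMeasurable]
    simp only [uf_scale hcpos]
  rw [eI, eI] at key
  simp only [charFun_map_mul] at key
  rw [intervalIntegral.integral_comp_mul_left (fun t => ‖charFun P t‖) hcpos.ne',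
    intervalIntegral.integral_comp_mul_left (fun t => ‖charFun Q t‖) hcpos.ne',
    intervalIntegral.integral_comp_mul_left (fun t => ‖charFun P t - charFun Q t‖) hcpos.ne',
    mul_zero, mul_one, smul_eq_mul, smul_eq_mul, smul_eq_mul, hcinv] at key
  have cle : c ≤ 2 * Real.pi * c := by nlinarith [Real.pi_gt_three]
  have k1 : ∫ t in (0:ℝ)..c, ‖charFun P t‖ ≤ G0 := by
    refine interval_bound hcpos.le intervalIntegrable_charFun.norm integrable_g0
      (fun x => (Real.exp_pos _).le) (fun x hx => bP x ?_)
    rw [abs_of_nonneg hx.1, ← hcε]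
    gcongr; exact hx.2.trans cle
  have k2 : ∫ t in (0:ℝ)..c, ‖charFun Q t‖ ≤ G0 :=
    interval_bound hcpos.le intervalIntegrable_charFun.norm integrable_g0
      (fun x => (Real.exp_pos _).le) (fun x hx => bQ x)
  have k3 : ∫ t in (c * -(2 * Real.pi))..(c * (2 * Real.pi)), ‖charFun P t - charFun Q t‖ ≤
      ε * G3 := by
    rw [hG3, ← integral_const_mul]
    refine interval_bound (by nlinarith)
      (intervalIntegrable_charFun.sub intervalIntegrable_charFun).norm (integrable_g3.const_mul ε)
      (fun x => by positivity) (fun x hx => bD x ?_)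
    have : |x| ≤ 2 * Real.pi * c := abs_le.2 ⟨by linarith [hx.1], by linarith [hx.2]⟩
    rw [← hcε]; gcongr
  refine key.trans ?_
  have e1 : β / c = 20 * Real.pi * ε * β := by rw [← hcinv]; field_simp
  have e2 : 1 / (β / c) * (20 * Real.pi * ε * (ε * G3)) = ε * G3 / β := by
    rw [← hcinv]; field_simp
  have e3 : ε * G3 / β ≤ ε * β * G3 := by
    rw [div_le_iff₀ (by linarith)]
    have h0 : 0 ≤ ε * G3 := by positivity
    have h1 : ε * β * G3 * β = ε * G3 * (β * β) := by ring
    rw [h1]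
    exact le_mul_of_one_le_right h0 (by nlinarith)
  rw [mul_assoc C]
  refine mul_le_mul_of_nonneg_left ?_ hC.le
  calc _ ≤ β / c + 20 * Real.pi * ε * G0 + 20 * Real.pi * ε * G0 +
        1 / (β / c) * (20 * Real.pi * ε * (ε * G3)) := by gcongr
    _ ≤ 20 * Real.pi * ε * β + 20 * Real.pi * ε * G0 + 20 * Real.pi * ε * G0 + ε * β * G3 := by
      rw [e2, e1]; gcongr
    _ ≤ _ := by
      have : 0 ≤ Real.pi * ε * G0 := by positivity
      nlinarith

lemma tail_tilt {F : Measure ℝ} [IsProbabilityMeasure F] {h A : ℝ}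
    (hA : (∫ y, Real.exp (h * y) ∂F) = Real.exp A) (x : ℝ) :
    1 - cdf F x = Real.exp (A - h * x) *
      ∫ y, uf h y ∂((F.tilted (fun y => h * y)).map (fun y => y - x)) := by
  have hmeas : Measurable (fun y : ℝ => y - x) := by fun_prop
  rw [integral_map hmeas.aemeasurable (measurable_uf _).aestronglyMeasurable, integral_tilted, hA]
  have e : ∀ y : ℝ, (Real.exp (h * y) / Real.exp A) • uf h (y - x) =
      Real.exp (h * x - A) * Set.indicator (Set.Ioi x) (fun _ => (1:ℝ)) y := by
    intro y
    by_cases hy : x < y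
    · have : 0 < y - x := by linarith
      simp only [uf, this, if_true, Set.indicator_apply, Set.mem_Ioi, hy, smul_eq_mul, mul_one]
      rw [← Real.exp_sub, ← Real.exp_add]; congr 1; ring
    · have : ¬ 0 < y - x := by linarith
      simp [uf, this, hy]
  simp_rw [e]
  rw [integral_const_mul, ← mul_assoc, ← Real.exp_add]
  have e0 : A - h * x + (h * x - A) = 0 := by ring
  rw [e0, Real.exp_zero, one_mul, integral_indicator measurableSet_Ioi, cdf_eq_real]
  rw [← Set.compl_Iic, setIntegral_const, probReal_compl_eq_one_sub measurableSet_Iic]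
  simp

lemma charFun_tilt {F : Measure ℝ} [IsProbabilityMeasure F] {h A : ℝ}
    (hA : (∫ y, Real.exp (h * y) ∂F) = Real.exp A) (x t : ℝ) :
    charFun ((F.tilted (fun y => h * y)).map (fun y => y - x)) t =
      Complex.exp (-A - t * x * Complex.I) *
        ∫ y : ℝ, Complex.exp ((h + t * Complex.I) * y) ∂F := by
  have hmeas : Measurable (fun y : ℝ => y - x) := by fun_prop
  rw [charFun_apply_real, integral_map hmeas.aemeasurable (by fun_prop), integral_tilted, hA,
    ← integral_const_mul]
  congr 1
  ext y
  rw [← Real.exp_sub, Complex.real_smul, Complex.ofReal_exp, ← Complex.exp_add,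
    ← Complex.exp_add]
  congr 1
  push_cast
  ring

lemma prob_tilt {F : Measure ℝ} [IsProbabilityMeasure F] {h : ℝ}
    (hi : Integrable (fun y : ℝ => Real.exp (h * y)) F) (x : ℝ) :
    IsProbabilityMeasure ((F.tilted (fun y => h * y)).map (fun y => y - x)) := by
  have := isProbabilityMeasure_tilted hi
  exact Measure.isProbabilityMeasure_map (by fun_prop)

/-- Laplace transform of the positive part of the standard normal law. -/
def Jf (a : ℝ) : ℝ := ∫ y, uf a y ∂(gaussianReal 0 1)

lemma Jf_le_one {a : ℝ} (ha : 0 ≤ a) : Jf a ≤ 1 := by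
  have := integral_mono (integrable_uf ha (gaussianReal 0 1)) (integrable_const 1) (uf_le_one ha)
  simpa [Jf] using this

lemma Jf_anti {a b : ℝ} (ha : 0 ≤ a) (hab : a ≤ b) : Jf b ≤ Jf a := by
  refine integral_mono (integrable_uf (ha.trans hab) _) (integrable_uf ha _) (fun y => ?_)
  simp only [uf]
  split_ifs with hy
  · rw [Real.exp_le_exp]; nlinarith
  · exact le_rfl

lemma Jf_eq (a : ℝ) : Jf a = ∫ y, gaussianPDFReal 0 1 y * uf a y := by
  rw [Jf, integral_gaussianReal_eq_integral_smul one_ne_zero]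
  rfl

lemma integrable_pdf_uf {a : ℝ} (ha : 0 ≤ a) :
    Integrable (fun y => gaussianPDFReal 0 1 y * uf a y) := by
  refine (integrable_gaussianPDFReal 0 1).mul_bdd (c := 1)
    (measurable_uf a).aestronglyMeasurable
    (Filter.Eventually.of_forall fun y => by
      rw [Real.norm_of_nonneg (uf_nonneg a y)]; exact uf_le_one ha y)

lemma Jf_pos {a : ℝ} (ha : 0 ≤ a) : 0 < Jf a := by
  rw [Jf_eq, integral_pos_iff_support_of_nonneg
    (fun y => mul_nonneg (gaussianPDFReal_nonneg _ _ _) (uf_nonneg _ _)) (integrable_pdf_uf ha)]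
  refine lt_of_lt_of_le ?_ (measure_mono (s := Set.Ioi 0) ?_)
  · simp
  · intro y hy
    have h1 := gaussianPDFReal_pos 0 1 y one_ne_zero
    have h2 : uf a y ≠ 0 := by
      simp only [uf, if_pos (Set.mem_Ioi.1 hy)]; positivity
    exact mul_ne_zero h1.ne' h2

lemma Jf_mul_mono {a b : ℝ} (ha : 0 < a) (hab : a ≤ b) : a * Jf a ≤ b * Jf b := by
  have hb : 0 < b := ha.trans_le hab
  have hc : 0 < a / b := by positivity
  have hc1 : a / b ≤ 1 := (div_le_one hb).2 hab
  have e := Measure.integral_comp_mul_left (fun y => gaussianPDFReal 0 1 y * uf a y) (b / a)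
  have e' := Measure.integral_comp_mul_left (fun y => gaussianPDFReal 0 1 y * uf b y) (a / b)
  rw [← Jf_eq, inv_div, abs_of_pos (by positivity), smul_eq_mul] at e'
  have hmono : Jf a ≤ ∫ x, gaussianPDFReal 0 1 (a / b * x) * uf b (a / b * x) := by
    rw [Jf_eq]
    refine integral_mono (integrable_pdf_uf ha.le)
      ((integrable_pdf_uf hb.le).comp_mul_left' hc.ne') (fun y => ?_)
    have h1 : uf b (a / b * y) = uf a y := by
      have hy : 0 < a / b * y ↔ 0 < y := by
        constructor
        · intro h; exact (pos_iff_pos_of_mul_pos h).1 hc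
        · intro h; positivity
      have h2 : b * (a / b * y) = a * y := by field_simp
      simp only [uf, hy, h2]
    simp only
    rw [h1]
    refine mul_le_mul_of_nonneg_right ?_ (uf_nonneg _ _)
    simp only [gaussianPDFReal, NNReal.coe_one]
    refine mul_le_mul_of_nonneg_left ?_ (by positivity)
    rw [Real.exp_le_exp]
    have : (a / b * y - 0) ^ 2 ≤ (y - 0) ^ 2 := by
      have : (a / b) ^ 2 ≤ 1 := by nlinarith
      nlinarith [sq_nonneg y]
    linarith
  rw [e'] at hmono
  calc a * Jf a ≤ a * (b / a * Jf b) := by gcongr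
    _ = b * Jf b := by field_simp

lemma Jf_scale {v β : ℝ} (hv : 0 < v) :
    ∫ y, uf β y ∂(gaussianReal 0 v.toNNReal) = Jf (β * √v) := by
  have hs : 0 < √v := Real.sqrt_pos.2 hv
  have e : (gaussianReal 0 1).map (fun y => √v * y) = gaussianReal 0 v.toNNReal := by
    rw [gaussianReal_map_const_mul]
    congr 1
    · simp
    · ext; simp [Real.sq_sqrt hv.le, hv.le]
  rw [← e, integral_map (by fun_prop) (measurable_uf _).aestronglyMeasurable, Jf]
  congr 1
  ext y
  have hy : 0 < √v * y ↔ 0 < y := by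
    constructor
    · intro h; exact (pos_iff_pos_of_mul_pos h).1 hs
    · intro h; positivity
  simp only [uf, hy, mul_assoc]

lemma gauss_tail (x : ℝ) :
    1 - cdf (gaussianReal 0 1) x = Real.exp (-(x ^ 2 / 2)) * Jf x := by
  have hA : (∫ y, Real.exp (x * y) ∂(gaussianReal 0 1)) = Real.exp (x ^ 2 / 2) := by
    have := congrFun (mgf_id_gaussianReal (μ := 0) (v := 1)) x
    simpa [mgf] using this
  rw [tail_tilt hA x]
  have e : ((gaussianReal 0 1).tilted (fun y => x * y)).map (fun y => y - x) =
      gaussianReal 0 1 := by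
    have hi : Integrable (fun y : ℝ => Real.exp (x * y)) (gaussianReal 0 1) :=
      integrable_exp_mul_gaussianReal x
    have hP := prob_tilt hi x
    refine Measure.ext_of_charFun ?_
    ext t
    have hc := complexMGF_id_gaussianReal (μ := 0) (v := 1) (x + t * Complex.I)
    simp only [complexMGF, id] at hc
    rw [charFun_tilt hA x t, hc, charFun_gaussianReal, ← Complex.exp_add]
    congr 1
    push_cast
    linear_combination ((t:ℂ) ^ 2 / 2) * Complex.I_sq
  rw [e, Jf]
  congr 2
  ring

lemma log_Jf_diff {a b : ℝ} (ha : 4 / 5 ≤ a) (hb : 4 / 5 ≤ b) :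
    |Real.log (Jf a) - Real.log (Jf b)| ≤ 2 * |a - b| := by
  have key : ∀ a b : ℝ, 4 / 5 ≤ a → a ≤ b →
      |Real.log (Jf a) - Real.log (Jf b)| ≤ 2 * (b - a) := by
    intro a b ha hab
    have ha0 : 0 < a := by linarith
    have hb0 : 0 < b := by linarith
    have hJa := Jf_pos ha0.le
    have hJb := Jf_pos hb0.le
    have h1 := Real.log_le_log hJb (Jf_anti ha0.le hab)
    have h2 := Real.log_le_log (by positivity) (Jf_mul_mono ha0 hab)
    rw [Real.log_mul ha0.ne' hJa.ne', Real.log_mul hb0.ne' hJb.ne'] at h2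
    have h3 := Real.log_le_sub_one_of_pos (div_pos hb0 ha0)
    rw [Real.log_div hb0.ne' ha0.ne'] at h3
    have h4 : b / a - 1 ≤ 2 * (b - a) := by
      have : b / a - 1 = (b - a) / a := by field_simp
      rw [this, div_le_iff₀ ha0]
      nlinarith
    rw [abs_of_nonneg (by linarith)]
    linarith
  rcases le_total a b with h | h
  · rw [abs_sub_comm a b, abs_of_nonneg (by linarith : 0 ≤ b - a)]
    exact key a b ha h
  · rw [abs_sub_comm, abs_of_nonneg (by linarith : 0 ≤ a - b)]
    exact key b a hb h

lemma crude_lower {P : Measure ℝ} [IsProbabilityMeasure P] {h M c : ℝ} (hh : 1 ≤ h) (hM : 0 ≤ M)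
    (hc : 2 * Real.exp (-M) ≤ c) (hP : c ≤ ∫ y, uf 1 y ∂P) :
    Real.exp (-(2 * h * M)) ≤ ∫ y, uf h y ∂P := by
  have hpt : ∀ y, Real.exp (-(h * M)) * (uf 1 y - Real.exp (-M)) ≤ uf h y := by
    intro y
    simp only [uf]
    split_ifs with hy
    · rcases le_total y M with hyM | hyM
      · have h1 : Real.exp (-(h * M)) ≤ Real.exp (-(h * y)) := by
          rw [Real.exp_le_exp]; nlinarith
        have h2 : Real.exp (-(1 * y)) ≤ 1 := by rw [Real.exp_le_one_iff]; linarith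
        have h3 := Real.exp_pos (-M)
        have h4 := Real.exp_pos (-(h * M))
        nlinarith
      · have h1 : Real.exp (-(1 * y)) ≤ Real.exp (-M) := by
          rw [Real.exp_le_exp]; linarith
        have h4 := Real.exp_pos (-(h * M))
        have h5 := Real.exp_pos (-(h * y))
        nlinarith
    · have := mul_pos (Real.exp_pos (-(h * M))) (Real.exp_pos (-M))
      linarith
  have hI := integrable_uf (b := 1) (by norm_num) P
  have hmono := integral_mono ((hI.sub (integrable_const (Real.exp (-M)))).const_mul
    (Real.exp (-(h * M)))) (integrable_uf (by linarith : (0:ℝ) ≤ h) P) hpt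
  rw [integral_const_mul] at hmono
  simp only [Pi.sub_apply] at hmono
  rw [integral_sub hI (integrable_const _)] at hmono
  simp only [integral_const, probReal_univ, one_smul] at hmono
  refine le_trans ?_ hmono
  calc Real.exp (-(2 * h * M)) ≤ Real.exp (-(h * M)) * Real.exp (-M) := by
        rw [← Real.exp_add, Real.exp_le_exp]; nlinarith
    _ ≤ _ := by
        refine mul_le_mul_of_nonneg_left ?_ (Real.exp_pos _).le
        linarith

lemma log_ratio_bound : ∃ K c : ℝ, 0 < K ∧ 0 < c ∧ ∀ (P : Measure ℝ), IsProbabilityMeasure P →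
    ∀ (ε v h : ℝ), 0 < ε → ε ≤ c → 7 / 10 ≤ v → v ≤ 13 / 10 → 1 ≤ h →
    (∀ t : ℝ, |t| * ε ≤ 1 / 10 → ∃ r : ℂ, ‖r‖ ≤ ε * |t| ^ 3 ∧
      charFun P t = Complex.exp (-v * t ^ 2 / 2 + r)) →
    0 < (∫ y, uf h y ∂P) ∧
    |Real.log (∫ y, uf h y ∂P) - Real.log (Jf (h * √v))| ≤ K * (ε * h ^ 3) := by
  obtain ⟨C, hC, hcmp⟩ := compare_gauss
  have hJ2 := Jf_pos (a := 2) (by norm_num)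
  have hJ2' := Jf_le_one (a := 2) (by norm_num)
  have hJh := Jf_pos (a := 1 / 2) (by norm_num)
  set j := 1 / 2 * Jf (1 / 2) with hj
  have hj0 : 0 < j := by positivity
  set D := 2 * C / j with hD
  have hD0 : 0 < D := by positivity
  set M := -Real.log (Jf 2 / 4) with hM
  have hM0 : 0 ≤ M := by
    rw [hM]
    have := Real.log_nonpos (x := Jf 2 / 4) (by positivity) (by linarith)
    linarith
  have heM : Real.exp (-M) = Jf 2 / 4 := by
    rw [hM, neg_neg, Real.exp_log (by positivity)]
  refine ⟨2 * D + 4 * M * D, Jf 2 / (2 * C), by positivity, by positivity, ?_⟩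
  intro P hP ε v h hε hεc hv hv' hh hchar
  have hs1 : 1 / 2 ≤ √v := Real.le_sqrt_of_sq_le (by norm_num; linarith)
  have hs2 : √v ≤ 2 := Real.sqrt_le_iff.2 ⟨by norm_num, by linarith⟩
  have k1 := hcmp P hP ε v 1 hε hv le_rfl hchar
  have kh := hcmp P hP ε v h hε hv hh hchar
  rw [Jf_scale (by linarith)] at k1 kh
  rw [one_mul, mul_one] at k1
  have hE1 : Jf 2 / 2 ≤ ∫ y, uf 1 y ∂P := by
    have h1 := Jf_anti (by linarith : 0 ≤ √v) hs2
    have h2 : C * ε ≤ Jf 2 / 2 := by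
      rw [le_div_iff₀ (by positivity)] at hεc; linarith
    have := (abs_le.1 k1).1
    linarith
  have hcr := crude_lower (P := P) hh hM0 (by rw [heM]; linarith) hE1
  set E := ∫ y, uf h y ∂P with hE
  have hEpos : 0 < E := (Real.exp_pos _).trans_le hcr
  refine ⟨hEpos, ?_⟩
  have hhs : 1 / 2 ≤ h * √v := hs1.trans (le_mul_of_one_le_left (by linarith) hh)
  have hhs0 : 0 < h * √v := by linarith
  have hJ := Jf_pos hhs0.le
  have hJ1 := Jf_le_one hhs0.le
  have hJlow : j ≤ 2 * h * Jf (h * √v) := by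
    have h1 := Jf_mul_mono (by norm_num : (0:ℝ) < 1 / 2) hhs
    have h2 : h * √v ≤ 2 * h := by nlinarith
    exact h1.trans (mul_le_mul_of_nonneg_right h2 hJ.le)
  set J := Jf (h * √v) with hJdef
  have hε2 : 0 < ε * h ^ 2 := by positivity
  have hε23 : ε * h ^ 2 ≤ ε * h ^ 3 := by
    have e : ε * h ^ 3 = ε * h ^ 2 * h := by ring
    rw [e]; exact le_mul_of_one_le_right hε2.le hh
  have hq : |E / J - 1| ≤ D * (ε * h ^ 2) := by
    have : E / J - 1 = (E - J) / J := by field_simp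
    rw [this, abs_div, abs_of_pos hJ, div_le_iff₀ hJ]
    refine kh.trans ?_
    calc C * (ε * h) = D * (ε * h) / 2 * j := by rw [hD]; field_simp
      _ ≤ D * (ε * h) / 2 * (2 * h * J) := by gcongr
      _ = _ := by ring
  rw [← Real.log_div hEpos.ne' hJ.ne']
  have hqpos : 0 < E / J := div_pos hEpos hJ
  have hMD : 0 ≤ M * D * (ε * h ^ 3) := by positivity
  have hDD : D * (ε * h ^ 2) ≤ D * (ε * h ^ 3) := by gcongr
  have hDp : 0 < D * (ε * h ^ 2) := by positivity
  obtain ⟨q1, q2⟩ := abs_le.1 hq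
  rw [abs_le]
  constructor
  · rcases le_total (D * (ε * h ^ 2)) (1 / 2) with hc | hc
    · have h1 := Real.one_sub_inv_le_log_of_pos hqpos
      have h2 : 1 / 2 ≤ E / J := by linarith
      have h3 : -(2 * (D * (ε * h ^ 2))) ≤ 1 - (E / J)⁻¹ := by
        have : 1 - (E / J)⁻¹ = (E / J - 1) / (E / J) := by field_simp
        rw [this, le_div_iff₀ hqpos]
        have h4 : D * (ε * h ^ 2) * (1 / 2) ≤ D * (ε * h ^ 2) * (E / J) := by gcongr
        linarith
      linarith
    · have h1 : E ≤ E / J := by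
        rw [le_div_iff₀ hJ]; exact mul_le_of_le_one_right hEpos.le hJ1
      have h2 := Real.log_le_log (Real.exp_pos _) (hcr.trans h1)
      rw [Real.log_exp] at h2
      have h3 : 2 * h * M ≤ 4 * (M * D * (ε * h ^ 3)) := by
        have e : 4 * (M * D * (ε * h ^ 3)) = 2 * h * M * (2 * (D * (ε * h ^ 2))) := by ring
        rw [e]
        exact le_mul_of_one_le_right (by positivity) (by linarith)
      linarith
  · have h1 := Real.log_le_sub_one_of_pos hqpos
    linarith

lemma unit_case : ∃ K c : ℝ, 0 < K ∧ 0 < c ∧ ∀ (ε : ℝ) (F : Measure ℝ) (φ : ℂ → ℂ), 0 < ε →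
    IsProbabilityMeasure F → (∫ x : ℝ, x ∂F) = 0 → variance id F = 1 → IsCGF φ ε F → ε ≤ c →
    ∀ x : ℝ, 2 ≤ x → x * ε ≤ 1 / 5 → ∃ L : ℝ, |L| ≤ K * (ε * x ^ 3) ∧
      1 - cdf F x = (1 - cdf (gaussianReal 0 1) x) * Real.exp L := by
  obtain ⟨K, c, hK, hc, hmain⟩ := log_ratio_bound
  refine ⟨(K + 6) * 4, c, by positivity, hc, ?_⟩
  intro ε F φ hε hF hm hv hφ hεc x hx hx'
  obtain ⟨h, v, a, hh, hhε, hxh, hv1, ha, hExpInt, hA, hchar⟩ := saddle hε hm hv hφ hx hx'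
  have hP := prob_tilt hExpInt x
  have hv2 := abs_le.1 hv1
  have hxh2 := abs_le.1 hxh
  have hvl : 7 / 10 ≤ v := by linarith
  have hvu : v ≤ 13 / 10 := by linarith
  obtain ⟨hEpos, hL3⟩ := hmain _ hP ε v h hε hεc hvl hvu hh (by
    intro t ht
    obtain ⟨r, hr, hr2⟩ := hchar t ht
    refine ⟨r, hr, ?_⟩
    rw [charFun_tilt hA x t, hr2, ← Complex.exp_add]
    congr 1
    ring)
  rw [tail_tilt hA x, gauss_tail]
  set E := ∫ y, uf h y ∂((F.tilted (fun y => h * y)).map (fun y => y - x)) with hE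
  have hs1 : 4 / 5 ≤ √v := Real.le_sqrt_of_sq_le (by norm_num; linarith)
  have hhs : 4 / 5 ≤ h * √v := hs1.trans (le_mul_of_one_le_left (by linarith) hh)
  have hJx := Jf_pos (a := x) (by linarith)
  have hL2 := log_Jf_diff hhs (by linarith : 4 / 5 ≤ x)
  have hsv : |√v - 1| ≤ ε * h := by
    have e : (√v - 1) * (√v + 1) = v - 1 := by
      have := Real.mul_self_sqrt (by linarith : 0 ≤ v)
      linarith
    rw [← e, abs_mul, abs_of_pos (by linarith : 0 < √v + 1)] at hv1
    exact (le_mul_of_one_le_right (abs_nonneg _) (by linarith)).trans hv1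
  have hsx : |h * √v - x| ≤ 2 * (ε * h ^ 2) := by
    have e : h * √v - x = h * (√v - 1) - (x - h) := by ring
    rw [e]
    refine (abs_sub _ _).trans ?_
    rw [abs_mul, abs_of_pos (by linarith : 0 < h)]
    have h1 : h * |√v - 1| ≤ h * (ε * h) := by gcongr
    have e2 : h * (ε * h) = ε * h ^ 2 := by ring
    linarith
  have hε23 : ε * h ^ 2 ≤ ε * h ^ 3 := by
    have e : ε * h ^ 3 = ε * h ^ 2 * h := by ring
    have h0 : 0 < ε * h ^ 2 := by positivity
    rw [e]; exact le_mul_of_one_le_right h0.le hh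
  have hL1 : |a - h * x + x ^ 2 / 2| ≤ 2 * (ε * h ^ 3) := by
    have e : a - h * x + x ^ 2 / 2 = (a - h ^ 2 / 2) + (x - h) ^ 2 / 2 := by ring
    rw [e]
    refine (abs_add_le _ _).trans ?_
    have h1 : |(x - h) ^ 2 / 2| ≤ ε * h ^ 3 := by
      rw [abs_of_nonneg (by positivity), ← sq_abs]
      have h2 : |x - h| ^ 2 ≤ (ε * h ^ 2) ^ 2 := by gcongr
      have e2 : (ε * h ^ 2) ^ 2 = ε * h ^ 3 * (h * ε) := by ring
      have h3 : 0 < ε * h ^ 3 := by positivity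
      have h4 : ε * h ^ 3 * (h * ε) ≤ ε * h ^ 3 * (3 / 10) := by gcongr
      linarith
    linarith
  have hhx : h ^ 3 ≤ 4 * x ^ 3 := by
    have h1 : 7 / 10 * h ≤ x := by
      have e : ε * h ^ 2 = h * ε * h := by ring
      have e2 : h * ε * h ≤ 3 / 10 * h := by gcongr
      linarith [hxh2.1]
    have h2 : (7 / 10 * h) ^ 3 ≤ x ^ 3 := by gcongr
    have e3 : (7 / 10 * h) ^ 3 = 343 / 1000 * h ^ 3 := by ring
    have : 0 < h ^ 3 := by positivity
    linarith
  refine ⟨(a - h * x + x ^ 2 / 2) + (Real.log E - Real.log (Jf (h * √v))) +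
    (Real.log (Jf (h * √v)) - Real.log (Jf x)), ?_, ?_⟩
  · refine (abs_add_le _ _).trans ?_
    have h1 := abs_add_le (a - h * x + x ^ 2 / 2) (Real.log E - Real.log (Jf (h * √v)))
    have h2 : (K + 6) * (ε * h ^ 3) ≤ (K + 6) * (ε * (4 * x ^ 3)) := by gcongr
    linarith
  · have e : (a - h * x + x ^ 2 / 2) + (Real.log E - Real.log (Jf (h * √v))) +
      (Real.log (Jf (h * √v)) - Real.log (Jf x)) =
      (a - h * x) - (-(x ^ 2 / 2)) + Real.log E - Real.log (Jf x) := by ring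
    have e2 : Real.exp ((a - h * x) - (-(x ^ 2 / 2)) + Real.log E - Real.log (Jf x)) =
        Real.exp (a - h * x) / Real.exp (-(x ^ 2 / 2)) * E / Jf x := by
      rw [Real.exp_sub _ (Real.log (Jf x)), Real.exp_add, Real.exp_sub (a - h * x),
        Real.exp_log hEpos, Real.exp_log hJx]
    rw [e, e2]
    have h1 := Real.exp_pos (-(x ^ 2 / 2))
    generalize Real.exp (-(x ^ 2 / 2)) = w at h1
    field_simp

lemma cgf_scale {φ : ℂ → ℂ} {τ σ : ℝ} {F : Measure ℝ} (hσ : 0 < σ)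
    (hv : variance id F = σ ^ 2) (h : IsCGF φ τ F)
    (hv' : variance id (F.map (fun y => σ⁻¹ * y)) = 1) :
    IsCGF (fun z => φ ((σ⁻¹ : ℝ) * z)) (τ / σ) (F.map (fun y => σ⁻¹ * y)) := by
  have hmeas : Measurable (fun y : ℝ => σ⁻¹ * y) := by fun_prop
  refine ⟨by simpa using h.1, fun z hz => ?_⟩
  have hn : ‖((σ⁻¹ : ℝ) : ℂ) * z‖ = σ⁻¹ * ‖z‖ := by
    rw [norm_mul, Complex.norm_real, Real.norm_of_nonneg (by positivity)]
  have hz' : ‖((σ⁻¹ : ℝ) : ℂ) * z‖ * τ < 1 := by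
    rw [hn]
    calc σ⁻¹ * ‖z‖ * τ = ‖z‖ * (τ / σ) := by field_simp
      _ < 1 := hz
  obtain ⟨h1, h2, h3, h4⟩ := h.2 _ hz'
  have e : ∀ x : ℝ, z * ((σ⁻¹ * x : ℝ) : ℂ) = ((σ⁻¹ : ℝ) : ℂ) * z * x := by
    intro x; push_cast; ring
  refine ⟨?_, ?_, ?_, ?_⟩
  · rw [integrable_map_measure (by fun_prop) hmeas.aemeasurable]
    simpa only [Function.comp_def, e] using h1
  · rw [integral_map hmeas.aemeasurable (by fun_prop)]
    simpa only [e] using h2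
  · exact h3.comp_of_eq (by fun_prop) rfl
  · have d : iteratedDeriv 3 (fun z => φ ((σ⁻¹ : ℝ) * z)) z =
        ((σ⁻¹ : ℝ) : ℂ) ^ 3 * iteratedDeriv 3 φ ((σ⁻¹ : ℝ) * z) := by
      simp only [iteratedDeriv_succ, iteratedDeriv_zero]
      have d1 : ∀ f : ℂ → ℂ, deriv (fun z => f (((σ⁻¹ : ℝ) : ℂ) * z)) =
          fun z => ((σ⁻¹ : ℝ) : ℂ) * deriv f (((σ⁻¹ : ℝ) : ℂ) * z) := by
        intro f; ext z; rw [deriv_comp_mul_left, smul_eq_mul]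
      have d2 : ∀ (c : ℂ) (f : ℂ → ℂ), deriv (fun z => c * f z) = fun z => c * deriv f z := by
        intro c f; ext z; exact deriv_const_mul_field c
      rw [d1, d2, d1 (deriv φ), d2, d2, d1 (deriv (deriv φ))]
      ring
    rw [d, hv', norm_mul, norm_pow, Complex.norm_real, Real.norm_of_nonneg (by positivity)]
    rw [hv] at h4
    calc σ⁻¹ ^ 3 * ‖iteratedDeriv 3 φ ((σ⁻¹ : ℝ) * z)‖ ≤ σ⁻¹ ^ 3 * (τ * σ ^ 2) := by gcongr
      _ = _ := by field_simp

lemma cdf_scale {σ : ℝ} (hσ : 0 < σ) (F : Measure ℝ) [IsProbabilityMeasure F] (x : ℝ) :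
    cdf (F.map (fun y => σ⁻¹ * y)) (x / σ) = cdf F x := by
  have hmeas : Measurable (fun y : ℝ => σ⁻¹ * y) := by fun_prop
  have := Measure.isProbabilityMeasure_map (μ := F) hmeas.aemeasurable
  rw [cdf_eq_real, cdf_eq_real, map_measureReal_apply hmeas measurableSet_Iic]
  congr 1
  ext y
  simp only [Set.mem_preimage, Set.mem_Iic]
  rw [le_div_iff₀ hσ]
  have : σ⁻¹ * y * σ = y := by field_simp
  rw [this]

/-- Large deviation asymptotics for the class `A₁(τ)`: there are absolute constants
`c₈, c₉ > 0` such that if `τ/σ ≤ c₉` then for `2σ ≤ x ≤ σ²/(5τ)`,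
`1 - F(x) = (1 - Φ(x)) exp(θ c₈ (τ/σ)(x/σ)³)` for some `|θ| ≤ 1`. -/
theorem large_deviation_ratio_A1 :
    ∃ c₈ c₉ : ℝ, 0 < c₈ ∧ 0 < c₉ ∧
      ∀ (τ σ : ℝ), 0 < τ → 0 < σ →
        ∀ (F : Measure ℝ), IsProbabilityMeasure F → (∫ x : ℝ, x ∂F) = 0 →
          variance id F = σ ^ 2 → MemA1 τ F → τ / σ ≤ c₉ →
          ∀ x : ℝ, 2 * σ ≤ x → x ≤ σ ^ 2 / (5 * τ) →
            ∃ θ : ℝ, |θ| ≤ 1 ∧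
              1 - cdf F x =
                (1 - cdf (gaussianReal 0 (Real.toNNReal (σ ^ 2))) x) *
                  Real.exp (θ * c₈ * (τ / σ) * (x / σ) ^ 3) := by
  obtain ⟨K, c, hK, hc, hmain⟩ := unit_case
  refine ⟨K, c, hK, hc, ?_⟩
  intro τ σ hτ hσ F hF hm hv hA1 hτσ x hx hx'
  obtain ⟨φ, hφ⟩ := hA1
  have hmeas : Measurable (fun y : ℝ => σ⁻¹ * y) := by fun_prop
  have hF' := Measure.isProbabilityMeasure_map (μ := F) hmeas.aemeasurable
  have hm' : (∫ x : ℝ, x ∂(F.map (fun y => σ⁻¹ * y))) = 0 := by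
    rw [integral_map hmeas.aemeasurable (by fun_prop), integral_const_mul, hm, mul_zero]
  have hv' : variance id (F.map (fun y => σ⁻¹ * y)) = 1 := by
    rw [variance_map (by fun_prop) hmeas.aemeasurable]
    have := variance_const_mul σ⁻¹ id F
    simp only [id] at this
    rw [Function.comp_def]
    simp only [id]
    rw [this]
    rw [hv]
    field_simp
  have hx2 : 2 ≤ x / σ := by rw [le_div_iff₀ hσ]; exact hx
  have hx5 : x / σ * (τ / σ) ≤ 1 / 5 := by
    rw [le_div_iff₀ (by positivity)] at hx'
    rw [div_mul_div_comm, div_le_iff₀ (by positivity)]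
    nlinarith
  obtain ⟨L, hL, hLe⟩ := hmain (τ / σ) _ _ (by positivity) hF' hm' hv'
    (cgf_scale hσ hv hφ hv') hτσ (x / σ) hx2 hx5
  have hg : (gaussianReal 0 (Real.toNNReal (σ ^ 2))).map (fun y => σ⁻¹ * y) =
      gaussianReal 0 1 := by
    rw [gaussianReal_map_const_mul]
    congr 1
    · simp
    · ext
      have : 0 ≤ σ ^ 2 := by positivity
      simp [this]
      field_simp
  rw [cdf_scale hσ, ← hg, cdf_scale hσ] at hLe
  have hpos : 0 < K * (τ / σ * (x / σ) ^ 3) := by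
    have : 0 < x / σ := by linarith
    positivity
  refine ⟨L / (K * (τ / σ * (x / σ) ^ 3)), ?_, ?_⟩
  · rw [abs_div, abs_of_pos hpos, div_le_one hpos]
    exact hL
  · rw [hLe]
    congr 2
    have e : L / (K * (τ / σ * (x / σ) ^ 3)) * K * (τ / σ) * (x / σ) ^ 3 =
      L / (K * (τ / σ * (x / σ) ^ 3)) * (K * (τ / σ * (x / σ) ^ 3)) := by ring
    rw [e, div_mul_cancel₀ _ hpos.ne']
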